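/- Suppose the Beck–Chevalley transformation bc : φ_! ∘ β* ⟶ α* ∘ ψ_! (defined as the composite φ_!β* ⟶ φ_!β*ψ*ψ_! ⟶ φ_!φ*α*ψ_! ⟶ α*ψ_! using the unit of ψ_! ⊣ ψ*, the square isomorphism b, and the counit of φ_! ⊣ φ*) is a natural isomorphism, that the adjunction ψ_! ⊣ ψ* is an adjoint equivalence (its unit and counit are natural isomorphisms), and that the functors α* : 𝔹 ⥤ 𝔻 and β* : 𝔸 ⥤ ℂ are essentially surjective. Then the adjunction φ_! ⊣ φ* is an adjoint equivalence: its unit and counit are natural isomorphisms, so φ_! and φ* are equivalences of categories. -/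

import Mathlib

/-!
Beck–Chevalley squares (Batanin–White).  Setting: categories `A B C D`, adjunctions
`ψ! ⊣ ψ*` and `φ! ⊣ φ*`, functors `β* : A ⥤ C`, `α* : B ⥤ D` and a natural isomorphism
`b : β* ∘ ψ* ≅ φ* ∘ α*`.  If the Beck–Chevalley transformation is invertible, `ψ! ⊣ ψ*`
is an adjoint equivalence, and `α*`, `β*` are essentially surjective, then `φ! ⊣ φ*`
is an adjoint equivalence.
-/

open CategoryTheory

universe v₁ v₂ v₃ v₄ u₁ u₂ u₃ u₄

variable {A : Type u₁} {B : Type u₂} {C : Type u₃} {D : Type u₄}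
  [Category.{v₁} A] [Category.{v₂} B] [Category.{v₃} C] [Category.{v₄} D]

/-- The component at `Y : A` of the Beck–Chevalley transformation `φ! ∘ β* ⟶ α* ∘ ψ!`,
defined as the composite `φ!β* ⟶ φ!β*ψ*ψ! ⟶ φ!φ*α*ψ! ⟶ α*ψ!` using the unit of `ψ! ⊣ ψ*`,
the square isomorphism `b`, and the counit of `φ! ⊣ φ*`. -/
def beckChevalley (ψe : A ⥤ B) (ψs : B ⥤ A) (adjψ : ψe ⊣ ψs)
    (φe : C ⥤ D) (φs : D ⥤ C) (adjφ : φe ⊣ φs)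
    (βs : A ⥤ C) (αs : B ⥤ D) (b : ψs ⋙ βs ≅ αs ⋙ φs) (Y : A) :
    φe.obj (βs.obj Y) ⟶ αs.obj (ψe.obj Y) :=
  φe.map (βs.map (adjψ.unit.app Y)) ≫ φe.map (b.hom.app (ψe.obj Y)) ≫
    adjφ.counit.app (αs.obj (ψe.obj Y))

/-- If the Beck–Chevalley transformation is a natural isomorphism, the adjunction
`ψ! ⊣ ψ*` is an adjoint equivalence (its unit and counit are natural isomorphisms), and
`α*` and `β*` are essentially surjective, then the adjunction `φ! ⊣ φ*` is an adjoint
equivalence: its unit and counit are natural isomorphisms, so `φ!` and `φ*` are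
equivalences of categories. -/
theorem beckChevalley_transfer_equivalence
    (ψe : A ⥤ B) (ψs : B ⥤ A) (adjψ : ψe ⊣ ψs)
    (φe : C ⥤ D) (φs : D ⥤ C) (adjφ : φe ⊣ φs)
    (βs : A ⥤ C) (αs : B ⥤ D) (b : ψs ⋙ βs ≅ αs ⋙ φs)
    (hbc : ∀ Y : A, IsIso (beckChevalley ψe ψs adjψ φe φs adjφ βs αs b Y))
    (hψu : IsIso adjψ.unit) (hψc : IsIso adjψ.counit)
    (hα : αs.EssSurj) (hβ : βs.EssSurj) :
    IsIso adjφ.unit ∧ IsIso adjφ.counit ∧ φe.IsEquivalence ∧ φs.IsEquivalence := by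
  have hU : ∀ c : C, IsIso (adjφ.unit.app c) := by
    intro c
    have h : ∀ Y : A, IsIso (adjφ.unit.app (βs.obj Y)) := by
      intro Y
      have := hbc Y
      have e : adjφ.unit.app (βs.obj Y) ≫
          φs.map (beckChevalley ψe ψs adjψ φe φs adjφ βs αs b Y) =
          βs.map (adjψ.unit.app Y) ≫ b.hom.app (ψe.obj Y) := by
        simp only [beckChevalley, Functor.map_comp]
        erw [adjφ.unit_naturality_assoc, adjφ.unit_naturality_assoc,
          adjφ.right_triangle_components]
        erw [Category.comp_id]
      have h2 : IsIso (adjφ.unit.app (βs.obj Y) ≫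
          φs.map (beckChevalley ψe ψs adjψ φe φs adjφ βs αs b Y)) := by
        rw [e]; infer_instance
      exact IsIso.of_isIso_comp_right _
        (φs.map (beckChevalley ψe ψs adjψ φe φs adjφ βs αs b Y))
    exact (NatTrans.isIso_app_iff_of_iso adjφ.unit (βs.objObjPreimageIso c)).1 (h _)
  have hC : ∀ d : D, IsIso (adjφ.counit.app d) := by
    intro d
    have h : ∀ Y : A, IsIso (adjφ.counit.app (αs.obj (ψe.obj Y))) := by
      intro Y
      have h1 := hbc Y
      unfold beckChevalley at h1
      have h2 := @IsIso.of_isIso_comp_left _ _ _ _ _ _ _ inferInstance h1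
      exact IsIso.of_isIso_comp_left (φe.map (b.hom.app (ψe.obj Y))) _
    exact (NatTrans.isIso_app_iff_of_iso adjφ.counit
      (αs.mapIso (asIso (adjψ.counit.app (αs.objPreimage d))) ≪≫
        αs.objObjPreimageIso d)).1 (h _)
  have i1 : IsIso adjφ.unit := NatIso.isIso_of_isIso_app _
  have i2 : IsIso adjφ.counit := NatIso.isIso_of_isIso_app _
  exact ⟨i1, i2, adjφ.toEquivalence.isEquivalence_functor,
    adjφ.toEquivalence.isEquivalence_inverse⟩
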